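/- The symmetric power Sym^d(𝔸^n) = (𝔸^n)^d / Σ_d over a field k is a rational variety; equivalently, the field of fractions of the ring of invariants k[x_{ij} : 1 ≤ i ≤ d, 1 ≤ j ≤ n]^{Σ_d} (where Σ_d permutes the index i) is a purely transcendental extension of k of transcendence degree dn. -/

import Mathlib

open MvPolynomial

/-- The subalgebra of `Σ_d`-invariant polynomials in the variables `x_{ij}`,
`1 ≤ i ≤ d`, `1 ≤ j ≤ n`, where the symmetric group `Σ_d` permutes the index `i`.
This is the coordinate ring of the symmetric power `Sym^d(𝔸^n) = (𝔸^n)^d / Σ_d`. -/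
def symmetricPowerInvariants (k : Type) [Field k] (d n : ℕ) :
    Subalgebra k (MvPolynomial (Fin d × Fin n) k) where
  carrier := {p | ∀ σ : Equiv.Perm (Fin d),
    MvPolynomial.rename (fun q => (σ q.1, q.2)) p = p}
  mul_mem' := fun hp hq σ => by rw [map_mul, hp σ, hq σ]
  add_mem' := fun hp hq σ => by rw [map_add, hp σ, hq σ]
  algebraMap_mem' := fun r σ => by
    simp [MvPolynomial.algebraMap_eq, MvPolynomial.rename_C]

/-- Symmetric polynomials over `L` take values in `L` once the elementary ones do. -/
lemma mattuck_symm_mem {k K : Type} [Field k] [Field K] [Algebra k K] {d : ℕ}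
    (x : Fin d → K) (L : IntermediateField k K)
    (he : ∀ m : Fin d, aeval x (esymm (Fin d) k (m + 1)) ∈ L)
    (g : MvPolynomial (Fin d) L) (hg : g.IsSymmetric) : aeval x g ∈ L := by
  obtain ⟨h, hh⟩ := esymmAlgHom_fin_surjective (R := L) (n := d) (m := d) le_rfl ⟨g, hg⟩
  have h1 : g = aeval (fun i : Fin d ↦ esymm (Fin d) L (i + 1)) h := by
    rw [← esymmAlgHom_apply, hh]
  have h2 : ∀ m : Fin d, aeval x (esymm (Fin d) L (m + 1)) =
      algebraMap L K ⟨_, he m⟩ := by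
    intro m
    rw [← map_esymm (Fin d) k (m + 1) (algebraMap k L), aeval_map_algebraMap]
    rfl
  rw [h1, ← AlgHom.comp_apply, comp_aeval]
  simp only [h2]
  change aeval (algebraMap L K ∘ fun i : Fin d => (⟨_, he i⟩ : L)) h ∈ L
  rw [aeval_algebraMap_apply]
  exact SetLike.coe_mem _

lemma mattuck_interp {k K : Type} [Field k] [Field K] [Algebra k K] {d : ℕ}
    (x : Fin d → K) (hx : Function.Injective x) (L : IntermediateField k K)
    (he : ∀ m : Fin d, aeval x (esymm (Fin d) k (m + 1)) ∈ L)
    (y : Fin d → K) (hy : ∀ m : Fin d, ∑ i, x i ^ (m : ℕ) * y i ∈ L) :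
    ∃ a : Fin d → L, ∀ i, y i = ∑ m : Fin d, x i ^ (m : ℕ) * (a m : K) := by
  classical
  have hps : ∀ r : ℕ, ∑ i, x i ^ r ∈ L := by
    intro r
    have := mattuck_symm_mem x L he (psum (Fin d) L r) (psum_isSymmetric _ _ _)
    simpa [psum] using this
  let H : Matrix (Fin d) (Fin d) L := fun m m' => ⟨∑ i, x i ^ ((m : ℕ) + m'), hps _⟩
  let p : Fin d → L := fun m => ⟨_, hy m⟩
  let V := Matrix.vandermonde x
  have hV : V.det ≠ 0 := Matrix.det_vandermonde_ne_zero_iff.2 hx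
  have hHV : H.map (algebraMap L K) = V.transpose * V := by
    ext m m'
    rw [Matrix.vandermonde_transpose_mul_vandermonde]
    rfl
  have hH : H.det ≠ 0 := by
    intro h0
    have : (H.map (algebraMap L K)).det = 0 := by
      rw [← RingHom.mapMatrix_apply, ← RingHom.map_det, h0, map_zero]
    rw [hHV, Matrix.det_mul, Matrix.det_transpose] at this
    exact hV (by simpa using this)
  let a : Fin d → L := H⁻¹.mulVec p
  have ha : H.mulVec a = p := by
    simp only [a, Matrix.mulVec_mulVec]
    rw [Matrix.mul_nonsing_inv _ (isUnit_iff_ne_zero.2 hH), Matrix.one_mulVec]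
  have ha' : (H.map (algebraMap L K)).mulVec (fun m => (a m : K)) = V.transpose.mulVec y := by
    ext m
    have := congrArg (algebraMap L K) (congrFun ha m)
    rw [RingHom.map_mulVec] at this
    exact this
  rw [hHV, ← Matrix.mulVec_mulVec] at ha'
  have hinj : Function.Injective V.transpose.mulVec :=
    Matrix.mulVec_injective_of_isUnit
      ((Matrix.isUnit_iff_isUnit_det _).2 (by simpa using hV))
  have := hinj ha'
  refine ⟨a, fun i => ?_⟩
  rw [← this]
  rfl

lemma mattuck_mem {k K : Type} [Field k] [Field K] [Algebra k K] {d n : ℕ}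
    (x : Fin d × Fin (n + 1) → K) (hx : Function.Injective fun i => x (i, 0))
    (L : IntermediateField k K)
    (he : ∀ m : Fin d, aeval (fun i => x (i, 0)) (esymm (Fin d) k (m + 1)) ∈ L)
    (hy : ∀ (m : Fin d) (j : Fin n), ∑ i, x (i, 0) ^ (m : ℕ) * x (i, j.succ) ∈ L)
    (f : MvPolynomial (Fin d × Fin (n + 1)) k) (hf : f ∈ symmetricPowerInvariants k d (n + 1)) :
    aeval x f ∈ L := by
  have hint : ∀ j : Fin (n + 1), ∃ P : Polynomial L,
      ∀ i, x (i, j) = Polynomial.aeval (x (i, 0)) P := by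
    intro j
    refine Fin.cases ⟨Polynomial.X, by simp⟩ (fun j => ?_) j
    obtain ⟨a, ha⟩ := mattuck_interp _ hx L he (fun i => x (i, j.succ)) (fun m => hy m j)
    refine ⟨∑ m : Fin d, Polynomial.C (a m) * Polynomial.X ^ (m : ℕ), fun i => ?_⟩
    rw [ha i]
    simp only [map_sum, map_mul, map_pow, Polynomial.aeval_C, Polynomial.aeval_X]
    exact Finset.sum_congr rfl fun m _ => mul_comm _ _
  choose P hP using hint
  let g : MvPolynomial (Fin d) L :=
    aeval (fun q : Fin d × Fin (n + 1) => Polynomial.aeval (X q.1) (P q.2)) f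
  have hg : g.IsSymmetric := by
    intro σ
    have h1 := hf σ
    conv_rhs => rw [show g = aeval (fun q : Fin d × Fin (n + 1) =>
      Polynomial.aeval (X q.1 : MvPolynomial (Fin d) L) (P q.2)) f from rfl, ← h1, aeval_rename]
    change ((rename σ : MvPolynomial (Fin d) L →ₐ[L] _).restrictScalars k) (aeval _ f) = _
    rw [← AlgHom.comp_apply, comp_aeval]
    congr 2
    funext q
    change rename σ (Polynomial.aeval (X q.1) (P q.2)) = _
    rw [← Polynomial.aeval_algHom_apply, rename_X]
    rfl
  have hfg : aeval x f = aeval (fun i => x (i, 0)) g := by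
    change _ = ((aeval (fun i => x (i, 0)) : MvPolynomial (Fin d) L →ₐ[L] _).restrictScalars k)
      (aeval _ f)
    rw [← AlgHom.comp_apply, comp_aeval]
    congr 2
    funext q
    change _ = aeval (fun i => x (i, 0)) (Polynomial.aeval (X q.1) (P q.2))
    rw [← Polynomial.aeval_algHom_apply, aeval_X, ← hP]
  rw [hfg]
  exact mattuck_symm_mem _ L he g hg

lemma mattuck_integral (k : Type) [Field k] (d n : ℕ) :
    Algebra.IsIntegral (symmetricPowerInvariants k d n) (MvPolynomial (Fin d × Fin n) k) := by
  letI : MulSemiringAction (Equiv.Perm (Fin d)) (MvPolynomial (Fin d × Fin n) k) :=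
    { smul := fun σ p => rename (fun q => (σ q.1, q.2)) p
      one_smul := fun p => by
        change rename (fun q : Fin d × Fin n => (q.1, q.2)) p = p
        exact rename_id_apply p
      mul_smul := fun σ τ p => by
        change rename _ _ = rename _ (rename _ _)
        rw [rename_rename]
        rfl
      smul_zero := fun σ => map_zero (rename (R := k) (fun q : Fin d × Fin n => (σ q.1, q.2)))
      smul_add := fun σ => map_add (rename (R := k) (fun q : Fin d × Fin n => (σ q.1, q.2)))
      smul_one := fun σ => map_one (rename (R := k) (fun q : Fin d × Fin n => (σ q.1, q.2)))
      smul_mul := fun σ => map_mul (rename (R := k) (fun q : Fin d × Fin n => (σ q.1, q.2))) }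
  have : Algebra.IsInvariant (symmetricPowerInvariants k d n)
      (MvPolynomial (Fin d × Fin n) k) (Equiv.Perm (Fin d)) :=
    ⟨fun b hb => ⟨⟨b, hb⟩, rfl⟩⟩
  exact Algebra.IsInvariant.isIntegral _ _ (Equiv.Perm (Fin d))

lemma mattuck_trdeg (k : Type) [Field k] (d n : ℕ) :
    Cardinal.mk (Fin (d * n)) ≤
      Algebra.trdeg k (FractionRing (symmetricPowerInvariants k d n)) := by
  have := mattuck_integral k d n
  have h1 := trdeg_add_eq k (symmetricPowerInvariants k d n)
    (A := MvPolynomial (Fin d × Fin n) k)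
  rw [trdeg_eq_zero (R := symmetricPowerInvariants k d n), add_zero, MvPolynomial.trdeg_of_isDomain] at h1
  have h2 := trdeg_le_of_injective
    (IsScalarTower.toAlgHom k (symmetricPowerInvariants k d n)
      (FractionRing (symmetricPowerInvariants k d n)))
    (IsFractionRing.injective _ _)
  rw [h1] at h2
  simpa using h2

/-- The invariant generators: elementary symmetric polynomials and polarized power sums. -/
noncomputable def mattuckGen (k : Type) [Field k] (d n : ℕ) (q : Fin d × Fin (n + 1)) :
    MvPolynomial (Fin d × Fin (n + 1)) k :=
  Fin.cases (rename (fun i => (i, 0)) (esymm (Fin d) k (q.1 + 1)))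
    (fun j => ∑ i, X (i, 0) ^ (q.1 : ℕ) * X (i, j.succ)) q.2

lemma mattuckGen_mem (k : Type) [Field k] (d n : ℕ) (q : Fin d × Fin (n + 1)) :
    mattuckGen k d n q ∈ symmetricPowerInvariants k d (n + 1) := by
  obtain ⟨m, j⟩ := q
  intro σ
  refine Fin.cases ?_ (fun j => ?_) j
  · simp only [mattuckGen, Fin.cases_zero]
    conv_rhs => rw [← rename_esymm (Fin d) k (m + 1) σ]
    rw [rename_rename, rename_rename]
    rfl
  · simp only [mattuckGen, Fin.cases_succ, map_sum, map_mul, map_pow, rename_X]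
    exact Equiv.sum_comp σ (fun i => (X (i, 0) : MvPolynomial (Fin d × Fin (n + 1)) k) ^ (m : ℕ) *
      X (i, j.succ))

lemma mattuck_adjoin (k : Type) [Field k] (d n : ℕ) :
    IntermediateField.adjoin k (Set.range fun q : Fin d × Fin (n + 1) =>
      algebraMap (symmetricPowerInvariants k d (n + 1))
        (FractionRing (symmetricPowerInvariants k d (n + 1)))
        ⟨mattuckGen k d n q, mattuckGen_mem k d n q⟩) = ⊤ := by
  set A := symmetricPowerInvariants k d (n + 1) with hA
  set M := IntermediateField.adjoin k (Set.range fun q : Fin d × Fin (n + 1) =>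
      algebraMap A (FractionRing A) ⟨mattuckGen k d n q, mattuckGen_mem k d n q⟩) with hM
  let R := MvPolynomial (Fin d × Fin (n + 1)) k
  let K := FractionRing R
  let ι : R →ₐ[k] K := IsScalarTower.toAlgHom k R K
  have hι : Function.Injective ι := IsFractionRing.injective R K
  have hg : Function.Injective (ι.comp A.val) := hι.comp Subtype.val_injective
  let φ : FractionRing A →ₐ[k] K := IsFractionRing.liftAlgHom hg
  have hφ : ∀ a : A, φ (algebraMap A _ a) = ι a := fun a => by
    simp only [φ, IsFractionRing.coe_liftAlgHom]
    exact IsFractionRing.lift_algebraMap _ _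
  have hgen : ∀ q, ι (mattuckGen k d n q) ∈ M.map φ := fun q => by
    rw [← hφ ⟨mattuckGen k d n q, mattuckGen_mem k d n q⟩]
    exact ⟨_, IntermediateField.subset_adjoin _ _ ⟨q, rfl⟩, rfl⟩
  have key : ∀ a : A, algebraMap A (FractionRing A) a ∈ M := by
    intro a
    have h := mattuck_mem (k := k) (fun q => ι (X q))
      (fun i i' h => by simpa using X_injective (hι h)) (M.map φ)
      (fun m => by
        have := hgen (m, 0)
        simp only [mattuckGen, Fin.cases_zero] at this
        have h3 : ι (rename (fun i => (i, 0)) (esymm (Fin d) k (m + 1))) =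
            aeval (fun i => ι (X (i, 0))) (esymm (Fin d) k (m + 1)) := by
          have h4 : ∀ p : R, aeval (fun q => ι (X q)) p = ι p := fun p => by
            rw [← comp_aeval_apply, aeval_X_left_apply]
          rw [← h4, aeval_rename]
          rfl
        rwa [h3] at this)
      (fun m j => by
        have := hgen (m, j.succ)
        simpa [mattuckGen] using this) a.1 a.2
    have h2 : aeval (fun q => ι (X q)) a.1 = ι a.1 := by
      rw [← comp_aeval_apply, aeval_X_left_apply]
    rw [h2, ← hφ] at h
    obtain ⟨b, hb, hb'⟩ := h
    rwa [← φ.injective hb']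
  rw [eq_top_iff]
  intro z _
  obtain ⟨a, b, -, rfl⟩ := IsFractionRing.div_surjective (A := A) z
  exact M.div_mem (key a) (key b)

/-- **Mattuck's theorem**: the symmetric power `Sym^d(𝔸^n)` of affine space over a field
`k` is rational: the fraction field of the ring of `Σ_d`-invariants of
`k[x_{ij} : 1 ≤ i ≤ d, 1 ≤ j ≤ n]` is a purely transcendental extension of `k` of
transcendence degree `d * n`. -/
theorem symmetricPower_affineSpace_rational (k : Type) [Field k] (d n : ℕ) :
    ∃ s : Fin (d * n) → FractionRing (symmetricPowerInvariants k d n),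
      AlgebraicIndependent k s ∧
      IntermediateField.adjoin k (Set.range s) = ⊤ := by
  obtain ⟨s, hs⟩ : ∃ s : Fin (d * n) → FractionRing (symmetricPowerInvariants k d n),
      IntermediateField.adjoin k (Set.range s) = ⊤ := by
    cases n with
    | zero =>
      refine ⟨fun _ => 0, ?_⟩
      rw [eq_top_iff]
      intro z _
      have key : ∀ a : symmetricPowerInvariants k d 0,
          algebraMap _ (FractionRing (symmetricPowerInvariants k d 0)) a ∈
            IntermediateField.adjoin k (Set.range fun _ : Fin (d * 0) =>
              (0 : FractionRing (symmetricPowerInvariants k d 0))) := by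
        intro a
        obtain ⟨c, hc⟩ := C_surjective (R := k) (Fin d × Fin 0) a.1
        have : a = algebraMap k _ c := Subtype.ext hc.symm
        rw [this, ← IsScalarTower.algebraMap_apply]
        exact IntermediateField.algebraMap_mem _ c
      obtain ⟨a, b, -, rfl⟩ :=
        IsFractionRing.div_surjective (A := symmetricPowerInvariants k d 0) z
      exact div_mem (key a) (key b)
    | succ n =>
      refine ⟨(fun q : Fin d × Fin (n + 1) =>
        algebraMap (symmetricPowerInvariants k d (n + 1))
          (FractionRing (symmetricPowerInvariants k d (n + 1)))
          ⟨mattuckGen k d n q, mattuckGen_mem k d n q⟩) ∘ finProdFinEquiv.symm, ?_⟩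
      rw [EquivLike.range_comp]
      exact mattuck_adjoin k d n
  refine ⟨s, ?_, hs⟩
  have : Algebra.IsAlgebraic (Algebra.adjoin k (Set.range s))
      (FractionRing (symmetricPowerInvariants k d n)) := by
    refine ⟨fun z => ?_⟩
    have hz : z ∈ IntermediateField.adjoin k (Set.range s) := hs ▸ IntermediateField.mem_top
    obtain ⟨a, ha, b, hb, rfl⟩ := IntermediateField.mem_adjoin_iff_div.1 hz
    rw [div_eq_mul_inv]
    exact (isAlgebraic_algebraMap (⟨a, ha⟩ : Algebra.adjoin k (Set.range s))).mul
      (isAlgebraic_algebraMap (⟨b, hb⟩ : Algebra.adjoin k (Set.range s))).inv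
  exact (Algebra.IsAlgebraic.isTranscendenceBasis_of_le_trdeg_of_finite k s
    (mattuck_trdeg k d n)).1
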